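/- Let (Z,A,S) be a normal regular bivariate Birkhoff interpolation scheme in which Z is (p,q)-rectangular, and let Ã ⊂ ℤ≥0² be obtained from A by moving some of the elements of A lying on the OX axis to other positions on the OX axis (so that Ã agrees with A off the OX axis and |Ã_x| = |A_x|). If the univariate scheme (Z_x, Ã_x, S_x) is regular, then (Z, Ã, S) is regular. -/

import Mathlib

open Finset

/-- A finite subset of `ℤ≥0²` is a *lower set* if it is closed under
coordinatewise decrease. -/
def IsLower (S : Finset (ℕ × ℕ)) : Prop :=
  ∀ u v, (u, v) ∈ S → ∀ i j, i ≤ u → j ≤ v → (i, j) ∈ S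

/-- The value at `(x,y)` of `∂^{i+j}P/∂x^i∂y^j`, where `P` is the polynomial
with coefficients `a` supported on `S`. -/
noncomputable def derivAt (S : Finset (ℕ × ℕ)) (a : ℕ × ℕ → ℝ) (i j : ℕ) (x y : ℝ) : ℝ :=
  ∑ uv ∈ S, a uv * (uv.1.descFactorial i : ℝ) * (uv.2.descFactorial j : ℝ) *
      x ^ (uv.1 - i) * y ^ (uv.2 - j)

/-- The bivariate Birkhoff scheme `(Z,A,S)` is *regular*: every interpolation
problem has a unique solution in `P_S` (polynomials supported on `S`). -/
def Regular (Z : Finset (ℝ × ℝ)) (A S : Finset (ℕ × ℕ)) : Prop :=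
  ∀ c : ℕ × ℕ → ℝ × ℝ → ℝ, ∃! a : ℕ × ℕ → ℝ,
    (∀ uv, uv ∉ S → a uv = 0) ∧
    ∀ z ∈ Z, ∀ ij ∈ A, derivAt S a ij.1 ij.2 z.1 z.2 = c ij z

/-- The scheme `(Z,A,S)` is *solvable*: every interpolation problem has at
least one solution in `P_S`. -/
def Solvable (Z : Finset (ℝ × ℝ)) (A S : Finset (ℕ × ℕ)) : Prop :=
  ∀ c : ℕ × ℕ → ℝ × ℝ → ℝ, ∃ a : ℕ × ℕ → ℝ,
    (∀ uv, uv ∉ S → a uv = 0) ∧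
    ∀ z ∈ Z, ∀ ij ∈ A, derivAt S a ij.1 ij.2 z.1 z.2 = c ij z

/-- `Z ⊂ ℝ²` is a `(p,q)`-rectangular set of nodes. -/
def IsRect (p q : ℕ) (Z : Finset (ℝ × ℝ)) : Prop :=
  ∃ x : Fin (p + 1) → ℝ, ∃ y : Fin (q + 1) → ℝ,
    Function.Injective x ∧ Function.Injective y ∧
    Z = (Finset.univ : Finset (Fin (p + 1) × Fin (q + 1))).image (fun ij => (x ij.1, y ij.2))

/-- `B_x = {i : (i,0) ∈ B}`. -/
def setX (B : Finset (ℕ × ℕ)) : Finset ℕ := (B.filter fun ij => ij.2 = 0).image Prod.fst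

/-- `B_y = {j : (0,j) ∈ B}`. -/
def setY (B : Finset (ℕ × ℕ)) : Finset ℕ := (B.filter fun ij => ij.1 = 0).image Prod.snd

/-- `B_x[β] = {α : (α,β) ∈ B}`. -/
def sliceX (B : Finset (ℕ × ℕ)) (b : ℕ) : Finset ℕ := (B.filter fun ij => ij.2 = b).image Prod.fst

/-- `B_y[α] = {β : (α,β) ∈ B}`. -/
def sliceY (B : Finset (ℕ × ℕ)) (a : ℕ) : Finset ℕ := (B.filter fun ij => ij.1 = a).image Prod.snd

/-- Projection of the nodes on the OX axis. -/
noncomputable def nodesX (Z : Finset (ℝ × ℝ)) : Finset ℝ := Z.image Prod.fst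

/-- Projection of the nodes on the OY axis. -/
noncomputable def nodesY (Z : Finset (ℝ × ℝ)) : Finset ℝ := Z.image Prod.snd

/-- The rectangle `R(u,v) = {(i,j) : i ≤ u, j ≤ v}`. -/
def rect (u v : ℕ) : Finset (ℕ × ℕ) := Finset.range (u + 1) ×ˢ Finset.range (v + 1)

/-- The blow-up `R^{p,q} = {(α,β) : (⌊α/(p+1)⌋, ⌊β/(q+1)⌋) ∈ R}`. -/
def blowup (p q : ℕ) (R : Finset (ℕ × ℕ)) : Finset (ℕ × ℕ) :=
  (R ×ˢ (Finset.range (p + 1) ×ˢ Finset.range (q + 1))).image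
    (fun x => ((p + 1) * x.1.1 + x.2.1, (q + 1) * x.1.2 + x.2.2))

/-- `n_{p,q}(L)`: number of `(α,β) ∈ L` with `(p+1) ∣ α` and `(q+1) ∣ β`. -/
def npq (p q : ℕ) (L : Finset (ℕ × ℕ)) : ℕ :=
  (L.filter fun ab => (p + 1) ∣ ab.1 ∧ (q + 1) ∣ ab.2).card

/-- Value at `x` of the `i`-th derivative of the univariate polynomial with
coefficients `a` supported on `S`. -/
noncomputable def derivAt1 (S : Finset ℕ) (a : ℕ → ℝ) (i : ℕ) (x : ℝ) : ℝ :=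
  ∑ u ∈ S, a u * (u.descFactorial i : ℝ) * x ^ (u - i)

/-- Regularity of the univariate Birkhoff scheme `(W,A,S)`. -/
def Regular1 (W : Finset ℝ) (A S : Finset ℕ) : Prop :=
  ∀ c : ℕ → ℝ → ℝ, ∃! a : ℕ → ℝ,
    (∀ u, u ∉ S → a u = 0) ∧
    ∀ w ∈ W, ∀ i ∈ A, derivAt1 S a i w = c i w

/-- `(A,S)` is almost regular with respect to `(p,q)`-rectangular sets of nodes. -/
def AlmostRegular (p q : ℕ) (A S : Finset (ℕ × ℕ)) : Prop :=
  ∃ Z : Finset (ℝ × ℝ), IsRect p q Z ∧ Regular Z A S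


/-- Evaluation of a partial derivative as a linear functional of the coefficients. -/
noncomputable def derivAtLinear (S : Finset (ℕ × ℕ)) (i j : ℕ) (x y : ℝ) :
    (ℕ × ℕ → ℝ) →ₗ[ℝ] ℝ where
  toFun a := derivAt S a i j x y
  map_add' a b := by simp [derivAt, add_mul, Finset.sum_add_distrib]
  map_smul' r a := by simp [derivAt, Finset.mul_sum, mul_assoc]

theorem derivAtLinear_apply (S : Finset (ℕ × ℕ)) (i j : ℕ) (x y : ℝ) (a : ℕ × ℕ → ℝ) :
    derivAtLinear S i j x y a = derivAt S a i j x y := rfl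

/-- A normal scheme is regular as soon as its homogeneous problem has only the zero solution. -/
theorem regular_of_card_eq {Z : Finset (ℝ × ℝ)} {A S : Finset (ℕ × ℕ)}
    (hcard : S.card = Z.card * A.card)
    (hzero : ∀ a : ℕ × ℕ → ℝ, (∀ uv, uv ∉ S → a uv = 0) →
      (∀ z ∈ Z, ∀ ij ∈ A, derivAt S a ij.1 ij.2 z.1 z.2 = 0) → a = 0) :
    Regular Z A S := by
  intro c
  let E : (S → ℝ) →ₗ[ℝ] (ℕ × ℕ → ℝ) := Function.ExtendByZero.linearMap ℝ Subtype.val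
  have hE : ∀ f uv, uv ∉ S → E f uv = 0 := fun f uv huv =>
    Function.extend_apply' _ _ _ (by rintro ⟨w, rfl⟩; exact huv w.2)
  have hE' : ∀ f (w : S), E f w = f w := fun f w =>
    Subtype.val_injective.extend_apply f 0 w
  let T : (S → ℝ) →ₗ[ℝ] (Z × A → ℝ) :=
    LinearMap.pi fun k => derivAtLinear S k.2.1.1 k.2.1.2 k.1.1.1 k.1.1.2 ∘ₗ E
  have hT : Function.Injective T := by
    rw [← LinearMap.ker_eq_bot, LinearMap.ker_eq_bot']
    intro f hf
    have h0 : E f = 0 := hzero _ (hE f) fun z hz ij hij =>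
      congrFun hf (⟨z, hz⟩, ⟨ij, hij⟩)
    ext w
    rw [← hE' f w, h0]
    rfl
  have hdim : Module.finrank ℝ (S → ℝ) = Module.finrank ℝ (Z × A → ℝ) := by
    simp [hcard]
  obtain ⟨f, hf⟩ := (LinearMap.injective_iff_surjective_of_finrank_eq_finrank hdim).1 hT
    fun k => c k.2 k.1
  have hsol : ∀ z ∈ Z, ∀ ij ∈ A, derivAt S (E f) ij.1 ij.2 z.1 z.2 = c ij z :=
    fun z hz ij hij => congrFun hf (⟨z, hz⟩, ⟨ij, hij⟩)
  refine ⟨E f, ⟨hE f, hsol⟩, ?_⟩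
  rintro b ⟨hb, hbc⟩
  refine sub_eq_zero.1 (hzero _ (fun uv huv => ?_) fun z hz ij hij => ?_)
  · simp [hb uv huv, hE f uv huv]
  · rw [← derivAtLinear_apply, map_sub, derivAtLinear_apply, derivAtLinear_apply,
      hbc z hz ij hij, hsol z hz ij hij, sub_self]

/-- The coefficients of `P(·, y)`, where `P` has coefficients `a` supported on `S`. -/
noncomputable def restrictLine (S : Finset (ℕ × ℕ)) (a : ℕ × ℕ → ℝ) (y : ℝ) (u : ℕ) : ℝ :=
  ∑ uv ∈ S with uv.1 = u, a uv * y ^ uv.2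

theorem IsLower.fst_mem_setX {S : Finset (ℕ × ℕ)} (hS : IsLower S) {uv : ℕ × ℕ} (h : uv ∈ S) :
    uv.1 ∈ setX S :=
  mem_image.2 ⟨(uv.1, 0), mem_filter.2 ⟨hS uv.1 uv.2 h _ _ le_rfl (Nat.zero_le _), rfl⟩, rfl⟩

theorem mem_setX {B : Finset (ℕ × ℕ)} {i : ℕ} : i ∈ setX B ↔ (i, 0) ∈ B := by
  simp [setX]

theorem card_setX (B : Finset (ℕ × ℕ)) : (setX B).card = (B.filter fun ij => ij.2 = 0).card := by
  refine card_image_of_injOn fun a ha b hb hab => ?_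
  rw [mem_coe, mem_filter] at ha hb
  exact Prod.ext hab (ha.2.trans hb.2.symm)

theorem IsLower.restrictLine_eq_zero {S : Finset (ℕ × ℕ)} (hS : IsLower S) (a : ℕ × ℕ → ℝ)
    (y : ℝ) {u : ℕ} (hu : u ∉ setX S) : restrictLine S a y u = 0 := by
  refine sum_eq_zero fun uv huv => absurd ?_ hu
  obtain ⟨h, rfl⟩ := mem_filter.1 huv
  exact hS.fst_mem_setX h

theorem IsLower.derivAt1_restrictLine {S : Finset (ℕ × ℕ)} (hS : IsLower S) (a : ℕ × ℕ → ℝ)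
    (i : ℕ) (x y : ℝ) :
    derivAt1 (setX S) (restrictLine S a y) i x = derivAt S a i 0 x y := by
  rw [derivAt, ← sum_fiberwise_of_maps_to (fun uv huv => hS.fst_mem_setX huv)]
  refine sum_congr rfl fun u _ => ?_
  rw [restrictLine, sum_mul, sum_mul]
  refine sum_congr rfl fun uv huv => ?_
  obtain ⟨-, rfl⟩ := mem_filter.1 huv
  simp only [Nat.descFactorial_zero, Nat.cast_one, Nat.sub_zero]
  ring

theorem card_eq_of_move_on_axis {A Atil : Finset (ℕ × ℕ)}
    (hoff : ∀ ij : ℕ × ℕ, ij.2 ≠ 0 → (ij ∈ A ↔ ij ∈ Atil))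
    (hcard : (setX Atil).card = (setX A).card) : Atil.card = A.card := by
  have h : (Atil.filter fun ij => ¬ ij.2 = 0) = A.filter fun ij => ¬ ij.2 = 0 := by
    ext ij
    simp only [mem_filter]
    exact and_congr_left fun hij => (hoff ij hij).symm
  rw [← card_filter_add_card_filter_not (s := Atil) (fun ij => ij.2 = 0),
    ← card_filter_add_card_filter_not (s := A) (fun ij => ij.2 = 0), h,
    ← card_setX, ← card_setX, hcard]

/-- moving the elements of `A` lying on the OX axis to other
positions on the OX axis preserves regularity, provided the univariate scheme
`(Z_x, Ã_x, S_x)` is regular. -/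
theorem move_on_axis (p q : ℕ) (Z : Finset (ℝ × ℝ)) (A S Atil : Finset (ℕ × ℕ))
    (hZ : IsRect p q Z) (hS : IsLower S) (hnorm : S.card = Z.card * A.card)
    (hreg : Regular Z A S)
    (hoff : ∀ ij : ℕ × ℕ, ij.2 ≠ 0 → (ij ∈ A ↔ ij ∈ Atil))
    (hcard : (setX Atil).card = (setX A).card)
    (hx : Regular1 (nodesX Z) (setX Atil) (setX S)) :
    Regular Z Atil S := by
  refine regular_of_card_eq (by rw [hnorm, card_eq_of_move_on_axis hoff hcard]) fun a ha h0 => ?_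
  have hline : ∀ z ∈ Z, restrictLine S a z.2 = 0 := by
    intro z hz
    refine (hx 0).unique ⟨fun u => hS.restrictLine_eq_zero a z.2, fun w hw i hi => ?_⟩
      ⟨fun _ _ => rfl, fun w _ i _ => by simp [derivAt1]⟩
    have hwz : (w, z.2) ∈ Z := by
      obtain ⟨z', hz', rfl⟩ := mem_image.1 hw
      obtain ⟨x, y, -, -, rfl⟩ := hZ
      simp only [mem_image, mem_univ, true_and] at hz hz' ⊢
      obtain ⟨k, rfl⟩ := hz
      obtain ⟨l, rfl⟩ := hz'
      exact ⟨(l.1, k.2), rfl⟩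
    rw [hS.derivAt1_restrictLine]
    exact h0 _ hwz (i, 0) (mem_setX.1 hi)
  refine (hreg 0).unique ⟨ha, ?_⟩ ⟨fun _ _ => rfl, fun z _ ij _ => by simp [derivAt]⟩
  rintro z hz ⟨i, j⟩ hij
  rcases eq_or_ne j 0 with rfl | hj
  · rw [← hS.derivAt1_restrictLine, hline z hz]
    simp [derivAt1]
  · exact h0 z hz _ ((hoff (i, j) hj).1 hij)
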